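/- Let n ≥ 1, let L and Φ be the root lattice of type A_n, and for a permutation σ of {1,…,n+1} let w_σ be the automorphism of L given by permuting coordinates (w_σ(e_i) = e_{σ(i)}). Then w_σ is a quasi Coxeter element — i.e. there exist roots α_1,…,α_n ∈ Φ with w_σ = s_{α_1} ∘ ⋯ ∘ s_{α_n} and Σ_{i=1}^n ℤα_i = L — if and only if σ is a cycle of length n+1. -/

import Mathlib

/-- The standard basis vector `e i` of `ℤ^m`. -/
def std (m : ℕ) (i : Fin m) : Fin m → ℤ := Pi.single i 1

/-- The root system of type `A_n`: `{± (e_i - e_j) | 1 ≤ i < j ≤ n+1}` in `ℤ^{n+1}`. -/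
def PhiA (n : ℕ) : Set (Fin (n + 1) → ℤ) :=
  {v | ∃ i j : Fin (n + 1), i ≠ j ∧ v = std (n + 1) i - std (n + 1) j}

/-- The root lattice of type `A_n`: `{x ∈ ℤ^{n+1} | Σ_i x_i = 0}`. -/
def LA (n : ℕ) : Submodule ℤ (Fin (n + 1) → ℤ) :=
  LinearMap.ker (∑ i : Fin (n + 1), (LinearMap.proj i : (Fin (n + 1) → ℤ) →ₗ[ℤ] ℤ))

/-- The graph `G(A)` associated to a set `A` of roots of type `A_n`: vertices `1, …, n+1`,
with `i` and `j` adjacent iff `e_i - e_j ∈ A` or `e_j - e_i ∈ A`. -/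
def GA (n : ℕ) (A : Set (Fin (n + 1) → ℤ)) : SimpleGraph (Fin (n + 1)) where
  Adj i j := i ≠ j ∧
    (std (n + 1) i - std (n + 1) j ∈ A ∨ std (n + 1) j - std (n + 1) i ∈ A)
  symm := ⟨fun i j h => ⟨h.1.symm, h.2.symm⟩⟩
  loopless := ⟨fun i h => h.1 rfl⟩

/-- The standard scalar product on `ℤ^m`. -/
def dotZ {m : ℕ} (x y : Fin m → ℤ) : ℤ := ∑ i, x i * y i

/-- The reflection `s_α : x ↦ x - (2(x,α)/(α,α)) • α` (the division is exact for every
root `α` of the systems considered here, so this is the honest reflection). -/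
def reflZ {m : ℕ} (α : Fin m → ℤ) (x : Fin m → ℤ) : Fin m → ℤ :=
  x - ((2 * dotZ x α) / dotZ α α) • α

/-- Reflection in `e_i - e_j` is the transposition of coordinates. -/
lemma reflZ_root {m : ℕ} (i j : Fin m) (h : i ≠ j) :
    reflZ (std m i - std m j) = fun x k => x (Equiv.swap i j k) := by
  have key : ∀ y : Fin m → ℤ, dotZ y (std m i - std m j) = y i - y j := by
    intro y
    simp [dotZ, std, mul_sub, Finset.sum_sub_distrib, Pi.single_apply]
  have h2 : dotZ (std m i - std m j) (std m i - std m j) = 2 := by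
    rw [key]
    simp [std, Pi.single_apply, h, h.symm]
  funext x k
  rw [reflZ, h2, key, Int.mul_ediv_cancel_left _ (by norm_num)]
  by_cases hi : k = i
  · subst hi; simp [std, h]
  · by_cases hj : k = j
    · subst hj; simp [std, hi]
    · simp [std, hi, hj, Equiv.swap_apply_of_ne_of_ne hi hj]

lemma foldr_sub_mem {m : ℕ} (l : List (Fin m → ℤ)) (x : Fin m → ℤ) :
    x - l.foldr (fun α f => reflZ α ∘ f) id x ∈ Submodule.span ℤ {α | α ∈ l} := by
  induction l with
  | nil => simp
  | cons a l ih =>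
    have h1 : Submodule.span ℤ {α | α ∈ l} ≤ Submodule.span ℤ {α | α ∈ a :: l} :=
      Submodule.span_mono (fun α h => List.mem_cons_of_mem _ h)
    have h2 : a ∈ Submodule.span ℤ {α | α ∈ a :: l} := Submodule.subset_span (by simp)
    simp only [List.foldr_cons, Function.comp_apply]
    rw [reflZ, sub_sub_eq_add_sub, add_sub_right_comm]
    exact Submodule.add_mem _ (h1 ih) (Submodule.smul_mem _ _ h2)

lemma fixed_of_fixed {m : ℕ} (l : List (Fin m → ℤ)) (hl : LinearIndependent ℤ l.get)
    (x : Fin m → ℤ) (hx : l.foldr (fun α f => reflZ α ∘ f) id x = x) :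
    ∀ α ∈ l, reflZ α x = x := by
  induction l with
  | nil => simp
  | cons a l ih =>
    have htail : LinearIndependent ℤ l.get :=
      hl.comp (Fin.succ : Fin l.length → Fin (l.length + 1)) (Fin.succ_injective _)
    have hm := foldr_sub_mem l x
    simp only [List.foldr_cons, Function.comp_apply] at hx
    set y := l.foldr (fun α f => reflZ α ∘ f) id x with hy
    have hx' := hx
    rw [reflZ] at hx
    set c := (2 * dotZ y a) / dotZ a a with hc
    have hca : c • a ∈ Submodule.span ℤ {α | α ∈ l} := by
      have : c • a = -(x - y) := by rw [← hx]; abel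
      rw [this]; exact Submodule.neg_mem _ hm
    have hc0 : c = 0 := by
      apply hl.eq_zero_of_smul_mem_span (0 : Fin (l.length + 1)) c
      refine Submodule.span_mono ?_ hca
      intro α hα
      obtain ⟨k, hk⟩ := List.get_of_mem hα
      exact ⟨Fin.succ k, by simp [Fin.succ_ne_zero], by simpa using hk⟩
    have hyx : y = x := by rw [← hx, hc0]; simp
    intro α hα
    rcases List.mem_cons.1 hα with rfl | hα
    · rwa [hyx] at hx'
    · exact ih htail hyx α hα

lemma mem_LA {n : ℕ} (x : Fin (n + 1) → ℤ) : x ∈ LA n ↔ ∑ i, x i = 0 := by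
  simp [LA, LinearMap.sum_apply]

lemma std_sub_mem_LA {n : ℕ} (i j : Fin (n + 1)) : std (n + 1) i - std (n + 1) j ∈ LA n := by
  rw [mem_LA]; simp [std, Finset.sum_sub_distrib]

lemma finrank_LA (n : ℕ) : n ≤ Module.finrank ℤ (LA n) := by
  have h := Submodule.finrank_quotient_add_finrank (LinearMap.ker
    (∑ i : Fin (n + 1), (LinearMap.proj i : (Fin (n + 1) → ℤ) →ₗ[ℤ] ℤ)))
  rw [(LinearMap.quotKerEquivRange _).finrank_eq] at h
  have h2 := Submodule.finrank_le (LinearMap.range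
    (∑ i : Fin (n + 1), (LinearMap.proj i : (Fin (n + 1) → ℤ) →ₗ[ℤ] ℤ)))
  rw [Module.finrank_fin_fun] at h
  rw [Module.finrank_self] at h2
  have h3 : n ≤ Module.finrank ℤ (LinearMap.ker
    (∑ i : Fin (n + 1), (LinearMap.proj i : (Fin (n + 1) → ℤ) →ₗ[ℤ] ℤ))) := by omega
  exact h3

lemma linInd_of_span {n : ℕ} (l : List (Fin (n + 1) → ℤ)) (hlen : l.length = n)
    (hs : Submodule.span ℤ {α | α ∈ l} = LA n) : LinearIndependent ℤ l.get := by
  have hr : Set.range l.get = {α | α ∈ l} := by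
    ext α; simp [List.mem_iff_get]
  have hs' : Submodule.span ℤ (Set.range l.get) = LA n := by rw [hr, hs]
  rw [linearIndependent_iff_card_le_finrank_span, Set.finrank, hs', Fintype.card_fin, hlen]
  exact finrank_LA n

/-- Consecutive differences. -/
def roots (m : ℕ) : List (Fin m) → List (Fin m → ℤ)
  | [] => []
  | [_] => []
  | a :: b :: l => (std m a - std m b) :: roots m (b :: l)

lemma roots_length (m : ℕ) (a : Fin m) (l : List (Fin m)) :
    (roots m (a :: l)).length = l.length := by
  induction l generalizing a with
  | nil => rfl
  | cons b l ih => simp [roots, ih]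

lemma roots_mem (n : ℕ) (l : List (Fin (n + 1))) (hl : l.Nodup) :
    ∀ α ∈ roots (n + 1) l, α ∈ PhiA n := by
  induction l with
  | nil => simp [roots]
  | cons a l ih =>
    cases l with
    | nil => simp [roots]
    | cons b l =>
      intro α hα
      rcases List.mem_cons.1 hα with rfl | hα
      · exact ⟨a, b, by rintro rfl; simp at hl, rfl⟩
      · exact ih (List.nodup_cons.1 hl).2 α hα

lemma roots_foldr (m : ℕ) (l : List (Fin m)) (hl : l.Nodup) :
    (roots m l).foldr (fun α f => reflZ α ∘ f) id = fun x j => x (l.formPerm⁻¹ j) := by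
  induction l with
  | nil => simp [roots]; rfl
  | cons a l ih =>
    cases l with
    | nil => simp [roots]; rfl
    | cons b l =>
      have hab : a ≠ b := by rintro rfl; simp at hl
      rw [roots, List.foldr_cons, ih (List.nodup_cons.1 hl).2, reflZ_root _ _ hab,
        List.formPerm_cons_cons]
      funext x j
      simp

lemma roots_span (m : ℕ) (a : Fin m) (l : List (Fin m)) :
    ∀ b ∈ a :: l, std m b - std m a ∈ Submodule.span ℤ {α | α ∈ roots m (a :: l)} := by
  induction l generalizing a with
  | nil => intro b hb; simp at hb; subst hb; simp
  | cons c l ih =>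
    intro b hb
    rcases List.mem_cons.1 hb with rfl | hb
    · simp
    · have h1 := Submodule.span_mono (R := ℤ) (s := {α | α ∈ roots m (c :: l)})
        (t := {α | α ∈ roots m (a :: c :: l)})
        (fun α h => List.mem_cons_of_mem _ h) (ih c b hb)
      have h2 : std m a - std m c ∈ Submodule.span ℤ {α | α ∈ roots m (a :: c :: l)} :=
        Submodule.subset_span (by simp [roots])
      have := Submodule.sub_mem _ h1 h2
      rwa [sub_sub_sub_cancel_right] at this

/-- The coordinate-permutation `w_σ` (with `w_σ (e_i) = e_{σ(i)}`) is a quasi Coxeter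
element of the root lattice of type `A_n` iff `σ` is a cycle of length `n + 1`. -/
theorem stmt11 (n : ℕ) (hn : 1 ≤ n) (σ : Equiv.Perm (Fin (n + 1))) :
    (∃ l : List (Fin (n + 1) → ℤ), l.length = n ∧ (∀ α ∈ l, α ∈ PhiA n) ∧
      l.foldr (fun α f => reflZ α ∘ f) id = (fun x j => x (σ⁻¹ j)) ∧
      Submodule.span ℤ {α | α ∈ l} = LA n) ↔
    (σ.IsCycle ∧ σ.support.card = n + 1) := by
  classical
  constructor
  · rintro ⟨l, hlen, hroot, hw, hs⟩
    have hli := linInd_of_span l hlen hs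
    have hconst : ∀ x : Fin (n + 1) → ℤ, (∀ j, x (σ⁻¹ j) = x j) → ∀ a b, x a = x b := by
      intro x hx a b
      have hfix := fixed_of_fixed l hli x (by rw [hw]; funext j; exact hx j)
      let f : (Fin (n + 1) → ℤ) →ₗ[ℤ] ℤ := ∑ i, x i • LinearMap.proj i
      have hf : ∀ i j, f (std (n + 1) i - std (n + 1) j) = x i - x j := by
        intro i j
        simp [f, std, LinearMap.sum_apply, mul_sub, Finset.sum_sub_distrib, Pi.single_apply]
      have hle : LA n ≤ LinearMap.ker f := by
        rw [← hs, Submodule.span_le]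
        intro α hα
        have h := hfix α hα
        obtain ⟨i, j, hij, rfl⟩ := hroot α hα
        rw [reflZ_root i j hij] at h
        have h := congrFun h j
        simp only [Equiv.swap_apply_right] at h
        simp [hf, h]
      have := hle (std_sub_mem_LA a b)
      rw [LinearMap.mem_ker, hf] at this
      omega
    have hsame : ∀ a b, σ.SameCycle a b := by
      intro a b
      have := hconst (fun j => if σ.SameCycle a j then 1 else 0) (by
        intro j
        have h : σ.SameCycle a (σ⁻¹ j) ↔ σ.SameCycle a j :=
          Equiv.Perm.sameCycle_symm_apply_right
        simp only [h]) a b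
      by_contra hc
      simp [hc, Equiv.Perm.SameCycle.refl] at this
    have hne : ∀ a, σ a ≠ a := by
      intro a ha
      have hall : ∀ b, a = b := fun b => (hsame a b).eq_of_left ha
      have h0 := hall 0
      have h1 := hall (Fin.last n)
      have := congrArg Fin.val (h0.symm.trans h1)
      simp at this
      omega
    refine ⟨⟨0, hne 0, fun y _ => hsame 0 y⟩, ?_⟩
    have : σ.support = Finset.univ := by ext a; simp [hne a]
    rw [this]; simp
  · rintro ⟨hc, hcard⟩
    have hsupp : σ.support = Finset.univ := by
      rw [← Finset.card_eq_iff_eq_univ, hcard]; simp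
    have hlen : (σ.toList 0).length = n + 1 := by
      rw [Equiv.Perm.length_toList, hc.cycleOf_eq (by
        rw [← Equiv.Perm.mem_support, hsupp]; simp), hcard]
    have hform : (σ.toList 0).formPerm = σ := by
      rw [Equiv.Perm.formPerm_toList, hc.cycleOf_eq (by
        rw [← Equiv.Perm.mem_support, hsupp]; simp)]
    have hnd := Equiv.Perm.nodup_toList σ 0
    obtain ⟨a, l, hal⟩ : ∃ a l, σ.toList 0 = a :: l := by
      cases h : σ.toList 0 with
      | nil => simp [h] at hlen
      | cons a l => exact ⟨a, l, rfl⟩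
    rw [hal] at hlen hform hnd
    have hmem : ∀ b, b ∈ a :: l := by
      intro b
      have : (a :: l).toFinset = Finset.univ := by
        rw [← Finset.card_eq_iff_eq_univ, List.toFinset_card_of_nodup hnd, hlen]; simp
      rw [← List.mem_toFinset, this]; simp
    refine ⟨roots (n + 1) (a :: l), ?_, roots_mem n _ hnd, ?_, ?_⟩
    · rw [roots_length]; simpa using hlen
    · rw [roots_foldr _ _ hnd, hform]
    · apply le_antisymm
      · rw [Submodule.span_le]
        intro α hα
        obtain ⟨i, j, -, rfl⟩ := roots_mem n _ hnd α hα
        exact std_sub_mem_LA i j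
      · intro x hx
        rw [mem_LA] at hx
        have : x = ∑ i, x i • (std (n + 1) i - std (n + 1) a) := by
          simp only [smul_sub, Finset.sum_sub_distrib, ← Finset.sum_smul, hx]
          funext k
          simp [std, Finset.sum_apply, Pi.single_apply]
        rw [this]
        exact Submodule.sum_mem _ fun i _ =>
          Submodule.smul_mem _ _ (roots_span _ a l i (hmem i))
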